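/- Let q∈(q_m,q_{m+1}] for some m≥1 and let t∈T have q-expansion (t_i)=((t_{i,1}),(t_{i,2}))∈Ω2^ℕ with (t_{i,1}),(t_{i,2})∉{(−1)^∞,1^∞}. If (t_i) contains infinitely many occurrences of (0,0), then either one of (t_{i,1}),(t_{i,2}) ends with 0^∞, or (t_i) ends with ((ε_n 𝜀̄_n)^∞,(𝜀̄_n ε_n)^∞) for some 1≤n<m. -/

import Mathlib

open scoped Pointwise ENNReal
open Filter

noncomputable section

/-- The digit set Ω₁ = {(0,0),(0,1),(1,0)} ⊆ ℝ². -/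
def Omega1 : Set (ℝ × ℝ) := {((0:ℝ), (0:ℝ)), (0, 1), (1, 0)}

/-- The digit set Ω₂ = Ω₁ − Ω₁ ⊆ ℝ². -/
def Omega2 : Set (ℝ × ℝ) :=
  {((0:ℝ), (0:ℝ)), (0, 1), (1, 0), (-1, 0), (-1, 1), (0, -1), (1, -1)}

/-- The Sierpinski gasket in base `q`. -/
def gasket (q : ℝ) : Set (ℝ × ℝ) :=
  {x | ∃ c : ℕ → ℝ × ℝ, (∀ i, c i ∈ Omega1) ∧ x = ∑' i, (q ^ (i + 1))⁻¹ • c i}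

/-- `U_q`: points of `[-1/(q-1), 1/(q-1)]` having a unique `q`-expansion over `{-1,0,1}`. -/
def uniqSet (q : ℝ) : Set ℝ :=
  {s | s ∈ Set.Icc (-(1 / (q - 1))) (1 / (q - 1)) ∧
    ∃! t : ℕ → ℝ, (∀ i, t i ∈ ({-1, 0, 1} : Set ℝ)) ∧ s = ∑' i, t i / q ^ (i + 1)}

/-- The set `T`. -/
def Tset (q : ℝ) : Set (ℝ × ℝ) :=
  {t | t ∈ gasket q - gasket q ∧ t.1 ∈ uniqSet q ∧ t.2 ∈ uniqSet q}

/-- The set `D_q` of Hausdorff dimensions of intersections. -/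
def Dset (q : ℝ) : Set ℝ≥0∞ :=
  {d | ∃ t ∈ Tset q, d = dimH (gasket q ∩ ((· + t) '' gasket q))}

/-- The words `w_n` over `{0,1,2}`: `klWord 0 = w₁ = 2`,
`w_{n+1} = (w_n ⟨reflection of w_n⟩)⁺`. -/
def klWord : ℕ → List ℕ
  | 0 => [2]
  | n + 1 =>
    let w := klWord n ++ (klWord n).map (fun x => 2 - x)
    w.dropLast ++ [w.getLast?.getD 0 + 1]

/-- `isKLBase n p`: `p ∈ (2,3)` and `1` has (greedy) expansion `w_n 0^∞` in base `p`
w.r.t. `{0,1,2}`, i.e. `p = q_n`. -/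
def isKLBase (n : ℕ) (p : ℝ) : Prop :=
  p ∈ Set.Ioo (2 : ℝ) 3 ∧
    (1 : ℝ) = ∑ i ∈ Finset.range (klWord (n - 1)).length,
      ((klWord (n - 1)).getD i 0 : ℝ) / p ^ (i + 1)

/-- `1` has a unique expansion in base `p` w.r.t. the digit set `{0,1,2}`. -/
def uniqueOneExp (p : ℝ) : Prop :=
  ∃! c : ℕ → ℕ, (∀ i, c i ≤ 2) ∧ (1 : ℝ) = ∑' i, (c i : ℝ) / p ^ (i + 1)

/-- The Thue–Morse sequence. -/
def tm : ℕ → ℕ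
  | 0 => 0
  | n + 1 => if (n + 1) % 2 = 0 then tm ((n + 1) / 2) else 1 - tm ((n + 1) / 2)
decreasing_by all_goals omega

/-- `λ_i = τ_i − τ_{i−1}` (for `i ≥ 1`). -/
def lam (i : ℕ) : ℤ := (tm i : ℤ) - (tm (i - 1) : ℤ)

/-- The word `ε_n = λ₁ ⋯ λ_{2^n}`. -/
def eps (n : ℕ) : List ℤ := (List.range (2 ^ n)).map fun i => lam (i + 1)

/-- Reflection of a word over `{-1,0,1}`: each digit `x` is replaced by `-x`. -/
def reflect (w : List ℤ) : List ℤ := w.map fun x => -x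

/-- `w⁺`: the last digit is increased by `1`. -/
def plusOne (w : List ℤ) : List ℤ := w.dropLast ++ [w.getLast?.getD 0 + 1]

/-- `w⁻`: the last digit is decreased by `1`. -/
def minusOne (w : List ℤ) : List ℤ := w.dropLast ++ [w.getLast?.getD 0 - 1]

/-- The periodic sequence `w^∞` (the `(j+1)`-st term is `per w j`). -/
def per (w : List ℤ) : ℕ → ℤ := fun j => w.getD (j % w.length) 0

/-- `EndsWith x s`: the sequence `x` ends with (has tail) the sequence `s`. -/
def EndsWith {α : Type*} (x s : ℕ → α) : Prop := ∃ k, ∀ j, x (j + k) = s j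

/-- The digit set Ω₂ as a subset of ℤ × ℤ. -/
def Omega2Z : Set (ℤ × ℤ) :=
  {((0:ℤ), (0:ℤ)), (0, 1), (1, 0), (-1, 0), (-1, 1), (0, -1), (1, -1)}

/-- `E_{n,m}^i = (σ^i((ε_n ε̄_n)^∞), (ε_m ε̄_m)^∞)` (the `(j+1)`-st term is `Eseq n m i j`). -/
def Eseq (n m i : ℕ) : ℕ → ℤ × ℤ := fun j =>
  (per (eps n ++ reflect (eps n)) (j + i), per (eps m ++ reflect (eps m)) j)


/-- `A_k = a₁ ⋯ a_{2^k}` where `a_i = λ_{2i−1}`. -/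
def Aword (k : ℕ) : List ℤ := (List.range (2 ^ k)).map fun i => lam (2 * i + 1)

/-- `D_{k,k}^i = (σ^i((A_k Ā_k)^∞), (A_k Ā_k)^∞)`. -/
def Dseq (k i : ℕ) : ℕ → ℤ × ℤ := fun j =>
  (per (Aword k ++ reflect (Aword k)) (j + i), per (Aword k ++ reflect (Aword k)) j)

/-- `U_q'`: the set of sequences over `{-1,0,1}` which are the unique `q`-expansion
of the number they represent. -/
def uniqSeqSet (q : ℝ) : Set (ℕ → ℤ) :=
  {t | (∀ i, t i ∈ ({-1, 0, 1} : Set ℤ)) ∧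
    ∀ s : ℕ → ℤ, (∀ i, s i ∈ ({-1, 0, 1} : Set ℤ)) →
      (∑' i, (s i : ℝ) / q ^ (i + 1)) = (∑' i, (t i : ℝ) / q ^ (i + 1)) → s = t}

/-- `ε_{n-1} ε̄_{n-1}`, with the convention `ε_{-1} ε̄_{-1} := 00`. -/
def epsPair : ℕ → List ℤ
  | 0 => [0, 0]
  | n + 1 => eps n ++ reflect (eps n)

/-- The finite prefix
`(ε_0 ε̄_0)^{j_0} (ε_0 ε̄_1)^{l_0} ⋯ (ε_{M-1} ε̄_{M-1})^{j_{M-1}} (ε_{M-1} ε̄_M)^{l_{M-1}}`. -/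
def blockJL (j l : ℕ → ℕ) : ℕ → List ℤ
  | 0 => []
  | M + 1 => blockJL j l M
      ++ (List.replicate (j M) (eps M ++ reflect (eps M))).flatten
      ++ (List.replicate (l M) (eps M ++ reflect (eps (M + 1)))).flatten

/-- The tail of `t` starting at some position `k` follows the pattern
`(ε_0 ε̄_0)^{j_0}(ε_0 ε̄_1)^{l_0}(ε_1 ε̄_1)^{j_1}(ε_1 ε̄_2)^{l_1}⋯`. -/
def TailFollows (t : ℕ → ℤ) (j l : ℕ → ℕ) : Prop :=
  ∃ k, ∀ M, ∀ i < (blockJL j l M).length, t (i + k) = (blockJL j l M).getD i 0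

/-- As `TailFollows`, but for the reflection of the pattern. -/
def TailFollowsRefl (t : ℕ → ℤ) (j l : ℕ → ℕ) : Prop :=
  ∃ k, ∀ M, ∀ i < (blockJL j l M).length, t (i + k) = -(blockJL j l M).getD i 0

/-- `a_n = 0 λ₁ ⋯ λ_{2^n−1}`. -/
def aword (n : ℕ) : List ℤ := 0 :: ((List.range (2 ^ n - 1)).map fun i => lam (i + 1))

/-- `b_n = (−1) λ₁ ⋯ λ_{2^n−1}`. -/
def bword (n : ℕ) : List ℤ := (-1) :: ((List.range (2 ^ n - 1)).map fun i => lam (i + 1))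

/-- The transitions allowed by the matrix `A` on the alphabet `{a_n, b_n, ā_n, b̄_n}`:
`a→b, a→ā, b→ā, ā→a, ā→b̄, b̄→a`. -/
def allowedTrans (n : ℕ) (u v : List ℤ) : Prop :=
  (u = aword n ∧ (v = bword n ∨ v = reflect (aword n))) ∨
  (u = bword n ∧ v = reflect (aword n)) ∨
  (u = reflect (aword n) ∧ (v = aword n ∨ v = reflect (bword n))) ∨
  (u = reflect (bword n) ∧ v = aword n)


/-! ### The Thue–Morse sequence -/

theorem tm_le_one (n : ℕ) : tm n ≤ 1 := by
  induction n using Nat.strong_induction_on with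
  | _ n ih =>
    match n with
    | 0 => simp [tm]
    | n + 1 =>
      rw [tm]
      split_ifs
      · exact ih _ (by omega)
      · omega

theorem tm_two_mul (n : ℕ) : tm (2 * n) = tm n := by
  match n with
  | 0 => rfl
  | n + 1 =>
    rw [show 2 * (n + 1) = (2 * n + 1) + 1 by ring, tm, if_pos (by omega)]
    congr 1
    omega

theorem tm_two_mul_add_one (n : ℕ) : tm (2 * n + 1) = 1 - tm n := by
  rw [tm, if_neg (by omega)]
  congr 2
  omega

theorem tm_two_pow_add (n j : ℕ) (hj : j < 2 ^ n) : tm (2 ^ n + j) = 1 - tm j := by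
  induction n generalizing j with
  | zero =>
    obtain rfl : j = 0 := by simpa using hj
    simpa using tm_two_mul_add_one 0
  | succ n ih =>
    rw [pow_succ] at hj ⊢
    obtain ⟨k, rfl | rfl⟩ := Nat.even_or_odd' j
    · rw [show 2 ^ n * 2 + 2 * k = 2 * (2 ^ n + k) by ring, tm_two_mul, tm_two_mul,
        ih k (by omega)]
    · rw [show 2 ^ n * 2 + (2 * k + 1) = 2 * (2 ^ n + k) + 1 by ring, tm_two_mul_add_one,
        tm_two_mul_add_one, ih k (by omega)]

theorem tm_two_pow (n : ℕ) : tm (2 ^ n) = 1 := by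
  simpa [tm] using tm_two_pow_add n 0 (by positivity)

theorem lam_succ (i : ℕ) : lam (i + 1) = (tm (i + 1) : ℤ) - tm i := rfl

theorem lam_succ_mem (i : ℕ) : -1 ≤ lam (i + 1) ∧ lam (i + 1) ≤ 1 := by
  have h1 := tm_le_one i
  have h2 := tm_le_one (i + 1)
  rw [lam_succ]
  omega

theorem lam_two_pow_add (n i : ℕ) (hi : i + 1 < 2 ^ n) :
    lam (2 ^ n + i + 1) = -lam (i + 1) := by
  have h1 := tm_two_pow_add n i (by omega)
  have h2 := tm_two_pow_add n (i + 1) hi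
  have h3 := tm_le_one i
  have h4 := tm_le_one (i + 1)
  rw [← add_assoc] at h2
  rw [lam_succ, lam_succ]
  omega

theorem lam_two_pow_add_last (n i : ℕ) (hi : i + 1 = 2 ^ n) :
    lam (2 ^ n + i + 1) = -lam (i + 1) + 1 := by
  have h1 := tm_two_pow_add n i (by omega)
  have h2 := tm_two_pow n
  have h3 := tm_two_pow (n + 1)
  have h4 := tm_le_one i
  rw [pow_succ, show 2 ^ n * 2 = 2 ^ n + i + 1 by omega] at h3
  rw [← hi] at h2
  rw [lam_succ, lam_succ]
  omega

/-! ### The periodic sequences `(ε_n ε̄_n)^∞` -/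

theorem length_eps (n : ℕ) : (eps n).length = 2 ^ n := by simp [eps]

theorem length_reflect (w : List ℤ) : (reflect w).length = w.length := by simp [reflect]

theorem getD_eps (n i : ℕ) (hi : i < 2 ^ n) : (eps n).getD i 0 = lam (i + 1) := by
  simp [eps, List.getD_eq_getElem?_getD, hi]

theorem getD_reflect (w : List ℤ) (i : ℕ) : (reflect w).getD i 0 = -w.getD i 0 := by
  simp only [reflect, List.getD_eq_getElem?_getD, List.getElem?_map]
  cases w[i]? <;> simp

theorem getD_append_reflect (w : List ℤ) (i : ℕ) :
    (w ++ reflect w).getD i 0 =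
      if i < w.length then w.getD i 0 else -w.getD (i - w.length) 0 := by
  split_ifs with h
  · exact List.getD_append _ _ _ _ h
  · rw [List.getD_append_right _ _ _ _ (not_lt.1 h), getD_reflect]

theorem reflect_append (v w : List ℤ) : reflect (v ++ w) = reflect v ++ reflect w := by
  simp [reflect]

theorem reflect_reflect (w : List ℤ) : reflect (reflect w) = w := by
  simp [reflect]

theorem per_reflect (w : List ℤ) (j : ℕ) : per (reflect w) j = -per w j := by
  rw [per, per, length_reflect, getD_reflect]

theorem per_reflect_append (w : List ℤ) (j : ℕ) :
    per (reflect w ++ w) j = -per (w ++ reflect w) j := by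
  rw [← per_reflect, reflect_append, reflect_reflect]

theorem per_add_mul_length (w : List ℤ) (j c : ℕ) : per w (j + w.length * c) = per w j := by
  rw [per, per, Nat.add_mul_mod_self_left]

theorem length_eps_append_reflect (n : ℕ) :
    (eps n ++ reflect (eps n)).length = 2 ^ (n + 1) := by
  rw [List.length_append, length_reflect, length_eps, pow_succ, mul_two]

/-- `(ε_n ε̄_n)^∞` is the difference sequence of `(τ_0 ⋯ τ_{2^{n+1}-1})^∞`. -/
theorem per_eps_eq_sub (n i : ℕ) :
    per (eps n ++ reflect (eps n)) i =
      (tm ((i + 1) % 2 ^ (n + 1)) : ℤ) - tm (i % 2 ^ (n + 1)) := by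
  have hlt : i % 2 ^ (n + 1) < 2 ^ (n + 1) := Nat.mod_lt _ (by positivity)
  have hmod : (i + 1) % 2 ^ (n + 1) = (i % 2 ^ (n + 1) + 1) % 2 ^ (n + 1) := by simp
  rw [per, length_eps_append_reflect, hmod]
  generalize i % 2 ^ (n + 1) = r at hlt
  rw [getD_append_reflect, length_eps]
  rw [pow_succ] at hlt ⊢
  split_ifs with h
  · rw [getD_eps _ _ h, lam_succ, Nat.mod_eq_of_lt (by omega)]
  · obtain ⟨s, rfl⟩ := Nat.exists_eq_add_of_le (not_lt.1 h)
    rw [Nat.add_sub_cancel_left, getD_eps _ _ (by omega), lam_succ]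
    have h1 := tm_two_pow_add n s (by omega)
    have h3 := tm_le_one s
    have h4 := tm_le_one (s + 1)
    rcases Nat.lt_or_ge (s + 1) (2 ^ n) with hs | hs
    · have h2 := tm_two_pow_add n (s + 1) hs
      rw [Nat.mod_eq_of_lt (by omega)]
      rw [← add_assoc] at h2
      omega
    · have hs' : s + 1 = 2 ^ n := by omega
      have h2 := tm_two_pow n
      rw [show 2 ^ n + s + 1 = 2 ^ n * 2 by omega, Nat.mod_self, hs', h2, h1, tm]
      omega

theorem tm_two_mul_add_one_mod (n i : ℕ) :
    tm ((2 * i + 1) % 2 ^ (n + 1)) = 1 - tm ((2 * i) % 2 ^ (n + 1)) := by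
  have h : (2 * i + 1) % 2 ^ (n + 1) = 2 * (i % 2 ^ n) + 1 := by
    rw [pow_succ']
    have h2 : (2 * i + 1) / 2 = i := by omega
    rw [Nat.mod_mul, h2]
    omega
  rw [h, tm_two_mul_add_one, pow_succ', Nat.mul_mod_mul_left, tm_two_mul]

theorem per_eps_ne_zero_of_even (n i : ℕ) (hi : Even i) :
    per (eps n ++ reflect (eps n)) i ≠ 0 := by
  obtain ⟨k, rfl⟩ := hi
  rw [← two_mul, per_eps_eq_sub, tm_two_mul_add_one_mod]
  have := tm_le_one (2 * k % 2 ^ (n + 1))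
  omega

theorem per_eps_zero_ne_zero (i : ℕ) : per (eps 0 ++ reflect (eps 0)) i ≠ 0 := by
  have h : eps 0 ++ reflect (eps 0) = [1, -1] := by
    have h1 := tm_two_pow 0
    simp_all [eps, reflect, lam, tm]
  rw [h, per]
  rcases Nat.mod_two_eq_zero_or_one i with h | h <;> simp [h]

/-- If two shifted sequences `(ε_n ε̄_n)^∞` and `(ε_k ε̄_k)^∞` are simultaneously `0` somewhere
and never simultaneously `1` or `-1`, then they are opposite from that point on. -/
theorem eq_neg_of_both_zero {x y : ℕ → ℤ} {n k a b p : ℕ}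
    (hx : ∀ j, x (a + j) = per (eps n ++ reflect (eps n)) j)
    (hy : ∀ j, y (b + j) = per (eps k ++ reflect (eps k)) j)
    (hap : a ≤ p) (hbp : b ≤ p) (hxp : x p = 0) (hyp : y p = 0)
    (hpos : ∀ i, ¬(x i = 1 ∧ y i = 1)) (hneg : ∀ i, ¬(x i = -1 ∧ y i = -1)) (i : ℕ) :
    y (p + 1 + i) = -x (p + 1 + i) := by
  obtain ⟨c, rfl⟩ := Nat.exists_eq_add_of_le hap
  obtain ⟨d, hd⟩ := Nat.exists_eq_add_of_le hbp
  have hc : ¬Even c := fun h => per_eps_ne_zero_of_even n c h (by rw [← hx, hxp])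
  have hd' : ¬Even d := fun h => per_eps_ne_zero_of_even k d h (by rw [← hy, ← hd, hyp])
  obtain ⟨c, rfl⟩ := Nat.not_even_iff_odd.1 hc
  obtain ⟨d, rfl⟩ := Nat.not_even_iff_odd.1 hd'
  set X : ℕ → ℕ := fun i => tm (i % 2 ^ (n + 1)) with hX
  set Y : ℕ → ℕ := fun i => tm (i % 2 ^ (k + 1)) with hY
  have hxX (i : ℕ) : x (a + i) = (X (i + 1) : ℤ) - X i := by rw [hx, per_eps_eq_sub]
  have hyY (i : ℕ) : y (b + i) = (Y (i + 1) : ℤ) - Y i := by rw [hy, per_eps_eq_sub]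
  have hX1 (i : ℕ) : X i ≤ 1 := tm_le_one _
  have hY1 (i : ℕ) : Y i ≤ 1 := tm_le_one _
  have hXo (i : ℕ) : X (2 * i + 1) = 1 - X (2 * i) := tm_two_mul_add_one_mod n i
  have hYo (i : ℕ) : Y (2 * i + 1) = 1 - Y (2 * i) := tm_two_mul_add_one_mod k i
  have heven (i : ℕ) : Y (2 * (d + 1 + i)) = 1 - X (2 * (c + 1 + i)) := by
    have e1 := hxX (2 * (c + 1 + i))
    have e2 := hyY (2 * (d + 1 + i))
    rw [hXo] at e1
    rw [hYo, show b + 2 * (d + 1 + i) = a + 2 * (c + 1 + i) by omega] at e2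
    have := hX1 (2 * (c + 1 + i))
    have := hY1 (2 * (d + 1 + i))
    have := hpos (a + 2 * (c + 1 + i))
    have := hneg (a + 2 * (c + 1 + i))
    omega
  have hall (i : ℕ) : Y (2 * (d + 1) + i) = 1 - X (2 * (c + 1) + i) := by
    obtain ⟨j, rfl | rfl⟩ := Nat.even_or_odd' i
    · rw [← mul_add, ← mul_add, heven]
    · rw [← add_assoc, ← add_assoc, ← mul_add, ← mul_add, hXo, hYo, heven]
  have e1 := hxX (2 * (c + 1) + i)
  have e2 := hyY (2 * (d + 1) + i)
  rw [add_assoc _ i 1, hall, hall, ← add_assoc, ← add_assoc (2 * (c + 1))] at e2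
  rw [show a + (2 * c + 1) + 1 + i = a + (2 * (c + 1) + i) by ring, e1,
    show a + (2 * (c + 1) + i) = b + 2 * (d + 1) + i by omega, e2]
  have := hX1 (2 * (c + 1) + i)
  have := hX1 (2 * (c + 1) + i + 1)
  omega

/-! ### Lexicographic comparison with `λ₁λ₂⋯` -/

/-- The length `L` prefix of `a` is lexicographically smaller than that of `b`. -/
def PrefixLT (L : ℕ) (a b : ℕ → ℤ) : Prop :=
  ∃ i < L, (∀ k < i, a k = b k) ∧ a i < b i

/-- From position `N` on, all words of length `2^j` in `x` are strictly smaller than `ε_j`. -/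
def BelowEps (j N : ℕ) (x : ℕ → ℤ) : Prop :=
  ∀ n ≥ N, PrefixLT (2 ^ j) (fun i => x (n + i)) (fun i => lam (i + 1))

theorem follow_eps {j N n : ℕ} {x : ℕ → ℤ} (hx : BelowEps (j + 1) N x)
    (hx' : BelowEps (j + 1) N (-x)) (hn : N ≤ n) (h : ∀ k < 2 ^ j, x (n + k) = lam (k + 1)) :
    ∀ k < 2 ^ j, (-x) (n + 2 ^ j + k) = lam (k + 1) := by
  obtain ⟨i, hi, hieq, hilt⟩ := hx n hn
  obtain ⟨l, hl, hleq, hllt⟩ := hx' (n + 2 ^ j) (by omega)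
  simp only at hieq hilt hleq hllt
  intro k hk
  by_cases hlj : 2 ^ j ≤ l
  · exact hleq k (by omega)
  exfalso
  have hij : 2 ^ j ≤ i := by
    by_contra hij
    have := h i (by omega)
    omega
  obtain ⟨r, rfl⟩ := Nat.exists_eq_add_of_le hij
  rw [pow_succ] at hi
  rw [← add_assoc] at hilt
  simp only [Pi.neg_apply] at hleq hllt
  rcases lt_trichotomy l r with hlr | rfl | hlr
  · have h1 := hieq (2 ^ j + l) (by omega)
    rw [lam_two_pow_add j l (by omega), ← add_assoc] at h1
    omega
  · rcases Nat.lt_or_ge (l + 1) (2 ^ j) with hs | hs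
    · rw [lam_two_pow_add j l hs] at hilt
      omega
    · rw [lam_two_pow_add_last j l (by omega)] at hilt
      omega
  · have h1 := hleq r hlr
    rw [lam_two_pow_add j r (by omega)] at hilt
    omega

theorem eventually_per_of_follow {j N n : ℕ} {x : ℕ → ℤ} (hx : BelowEps (j + 1) N x)
    (hx' : BelowEps (j + 1) N (-x)) (hn : N ≤ n) (h : ∀ k < 2 ^ j, x (n + k) = lam (k + 1)) :
    ∀ i, x (n + i) = per (eps j ++ reflect (eps j)) i := by
  have hstep : ∀ c, ∀ k < 2 ^ j, x (n + 2 ^ (j + 1) * c + k) = lam (k + 1) ∧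
      -x (n + 2 ^ (j + 1) * c + 2 ^ j + k) = lam (k + 1) := by
    intro c
    induction c with
    | zero => exact fun k hk => ⟨by simpa using h k hk, by
        simpa using follow_eps hx hx' hn h k hk⟩
    | succ c ih =>
      have h1 : ∀ k < 2 ^ j, x (n + 2 ^ (j + 1) * (c + 1) + k) = lam (k + 1) := by
        intro k hk
        have := follow_eps (n := n + 2 ^ (j + 1) * c + 2 ^ j) hx' (by rwa [neg_neg])
          (by rw [add_assoc]; exact Nat.le_add_right_of_le hn)
          (fun k hk => (ih k hk).2) k hk
        rw [neg_neg] at this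
        rw [← this]
        congr 1
        ring
      exact fun k hk => ⟨h1 k hk, follow_eps hx hx' (Nat.le_add_right_of_le hn) h1 k hk⟩
  intro i
  have hlt : i % 2 ^ (j + 1) < 2 ^ (j + 1) := Nat.mod_lt _ (by positivity)
  have hi : n + i = n + 2 ^ (j + 1) * (i / 2 ^ (j + 1)) + i % 2 ^ (j + 1) := by
    rw [add_assoc, Nat.div_add_mod]
  rw [per, length_eps_append_reflect, hi]
  generalize i % 2 ^ (j + 1) = r at hlt
  generalize i / 2 ^ (j + 1) = c
  rw [getD_append_reflect, length_eps]
  split_ifs with hr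
  · rw [getD_eps _ _ hr, (hstep c r hr).1]
  · obtain ⟨s, rfl⟩ := Nat.exists_eq_add_of_le (not_lt.1 hr)
    rw [pow_succ] at hlt
    rw [Nat.add_sub_cancel_left, getD_eps _ _ (by omega), ← (hstep c s (by omega)).2, neg_neg,
      add_assoc, add_assoc, add_assoc]

theorem BelowEps.of_no_prefix {j N : ℕ} {x : ℕ → ℤ} (hx : BelowEps (j + 1) N x)
    (h : ∀ n ≥ N, ¬∀ k < 2 ^ j, x (n + k) = lam (k + 1)) : BelowEps j N x := by
  intro n hn
  obtain ⟨i, hi, hieq, hilt⟩ := hx n hn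
  refine ⟨i, ?_, hieq, hilt⟩
  by_contra hij
  exact h n hn fun k hk => hieq k (by omega)

/-- A sequence all of whose words of length `2^M` eventually lie strictly between `ε̄_M` and `ε_M`
ends with `0^∞` or with some `(ε_n ε̄_n)^∞`, `n < M`. -/
theorem tail_zero_or_per {M N : ℕ} {x : ℕ → ℤ} (hx : BelowEps M N x) (hx' : BelowEps M N (-x)) :
    (∃ a, ∀ i, x (a + i) = 0) ∨
      ∃ n < M, ∃ a, ∀ i, x (a + i) = per (eps n ++ reflect (eps n)) i := by
  induction M with
  | zero =>
    refine Or.inl ⟨N, fun i => ?_⟩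
    obtain ⟨a, ha, -, h1⟩ := hx (N + i) (by omega)
    obtain ⟨b, hb, -, h2⟩ := hx' (N + i) (by omega)
    obtain rfl : a = 0 := by simpa using ha
    obtain rfl : b = 0 := by simpa using hb
    have h3 := lam_succ_mem 0
    simp only [Pi.neg_apply, add_zero] at h1 h2
    omega
  | succ j ih =>
    by_cases h : ∃ n ≥ N, ∀ k < 2 ^ j, x (n + k) = lam (k + 1)
    · obtain ⟨n, hn, h⟩ := h
      exact Or.inr ⟨j, by omega, n, eventually_per_of_follow hx hx' hn h⟩
    by_cases h' : ∃ n ≥ N, ∀ k < 2 ^ j, (-x) (n + k) = lam (k + 1)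
    · obtain ⟨n, hn, h'⟩ := h'
      have h2 := follow_eps hx' (by rwa [neg_neg]) hn h'
      rw [neg_neg] at h2
      exact Or.inr ⟨j, by omega, n + 2 ^ j, eventually_per_of_follow hx hx'
        (Nat.le_add_right_of_le hn) h2⟩
    rcases ih (hx.of_no_prefix (by simpa using h)) (hx'.of_no_prefix (by simpa using h')) with
      h0 | ⟨n, hn, h0⟩
    · exact Or.inl h0
    · exact Or.inr ⟨n, by omega, h0⟩

/-! ### The base `q_{m+1}` -/

theorem length_klWord (n : ℕ) : (klWord n).length = 2 ^ n := by
  induction n with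
  | zero => rfl
  | succ n ih =>
    have : 0 < 2 ^ n := by positivity
    simp only [klWord, List.length_append, List.length_dropLast, List.length_map, ih,
      List.length_singleton, pow_succ]
    omega

theorem getD_klWord (n i : ℕ) (hi : i < 2 ^ n) :
    ((klWord n).getD i 0 : ℤ) = lam (i + 1) + 1 := by
  induction n generalizing i with
  | zero =>
    obtain rfl : i = 0 := by simpa using hi
    have h1 := tm_two_pow 0
    simp_all [klWord, lam, tm]
  | succ n ih =>
    have hlen := length_klWord n
    have hpos : 0 < 2 ^ n := by positivity
    have hrefl : ∀ k < 2 ^ n, ((((klWord n).map fun x => 2 - x).getD k 0 : ℕ) : ℤ) =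
        -lam (k + 1) + 1 := by
      intro k hk
      have h1 := ih k hk
      have h2 := lam_succ_mem k
      rw [List.getD_eq_getElem _ _ (by omega)] at h1
      rw [List.getD_eq_getElem _ _ (by simpa [hlen] using hk), List.getElem_map]
      omega
    set w := klWord n ++ (klWord n).map (fun x => 2 - x) with hw
    have hwlen : w.length = 2 ^ n + 2 ^ n := by simp [hw, hlen]
    have hkl : klWord (n + 1) = w.dropLast ++ [w.getLast?.getD 0 + 1] := rfl
    have hlow : ∀ k < 2 ^ n, w.getD k 0 = (klWord n).getD k 0 := fun k hk =>
      List.getD_append _ _ _ _ (by omega)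
    have hhigh : ∀ k, w.getD (2 ^ n + k) 0 = ((klWord n).map fun x => 2 - x).getD k 0 := by
      intro k
      rw [hw, List.getD_append_right _ _ _ _ (by omega), hlen, Nat.add_sub_cancel_left]
    rw [pow_succ] at hi
    rcases Nat.lt_or_ge (i + 1) (2 ^ n * 2) with h | h
    · have h1 : (klWord (n + 1)).getD i 0 = w.getD i 0 := by
        rw [hkl, List.getD_append _ _ _ _ (by rw [List.length_dropLast]; omega)]
        simp only [List.getD_eq_getElem?_getD, List.getElem?_dropLast]
        rw [if_pos (by omega)]
      rw [h1]
      rcases Nat.lt_or_ge i (2 ^ n) with h2 | h2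
      · rw [hlow i h2, ih i h2]
      · obtain ⟨k, rfl⟩ := Nat.exists_eq_add_of_le h2
        rw [hhigh, hrefl k (by omega), lam_two_pow_add n k (by omega)]
    · obtain ⟨k, rfl⟩ : ∃ k, i = 2 ^ n + k := ⟨i - 2 ^ n, by omega⟩
      have h1 : (klWord (n + 1)).getD (2 ^ n + k) 0 = w.getD (2 ^ n + k) 0 + 1 := by
        have hdl : w.dropLast.length = 2 ^ n + k := by rw [List.length_dropLast]; omega
        rw [hkl, List.getD_append_right _ _ _ _ (by omega), hdl, List.getLast?_eq_getElem?,
          List.getD_eq_getElem?_getD (l := w), (by omega : w.length - 1 = 2 ^ n + k)]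
        simp
      rw [h1, hhigh, Nat.cast_add, hrefl k (by omega), lam_two_pow_add_last n k (by omega)]
      simp

/-- The value of the length `L` prefix of `c` in base `q`. -/
def prefixVal (q : ℝ) (L : ℕ) (c : ℕ → ℤ) : ℝ :=
  ∑ i ∈ Finset.range L, (c i : ℝ) / q ^ (i + 1)

theorem prefixVal_succ (q : ℝ) (L : ℕ) (c : ℕ → ℤ) :
    prefixVal q (L + 1) c = (c 0 + prefixVal q L fun i => c (i + 1)) / q := by
  rw [prefixVal, Finset.sum_range_succ', prefixVal, add_div, Finset.sum_div, add_comm]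
  congr 1
  · simp
  · exact Finset.sum_congr rfl fun i _ => by rw [div_div, ← pow_succ]

theorem prefixVal_lam_double {q : ℝ} (hq : 0 < q) (n : ℕ) :
    prefixVal q (2 ^ (n + 1)) (fun i => lam (i + 1)) =
      prefixVal q (2 ^ n) (fun i => lam (i + 1)) * (1 - (q ^ 2 ^ n)⁻¹) +
        ((q ^ 2 ^ n)⁻¹) ^ 2 := by
  have hq0 := hq.ne'
  obtain ⟨K, hK⟩ : ∃ K, 2 ^ n = K + 1 :=
    Nat.exists_eq_succ_of_ne_zero (by positivity)
  have hsum : ∑ i ∈ Finset.range (2 ^ n), (lam (2 ^ n + i + 1) : ℝ) / q ^ (2 ^ n + i + 1) =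
      -(∑ i ∈ Finset.range (2 ^ n), (lam (i + 1) : ℝ) / q ^ (i + 1)) * (q ^ 2 ^ n)⁻¹ +
        ((q ^ 2 ^ n)⁻¹) ^ 2 := by
    have hterm : ∀ i ∈ Finset.range K, (lam (2 ^ n + i + 1) : ℝ) / q ^ (2 ^ n + i + 1) =
        -((lam (i + 1) : ℝ) / q ^ (i + 1) * (q ^ 2 ^ n)⁻¹) := by
      intro i hi
      rw [lam_two_pow_add n i (by have := Finset.mem_range.1 hi; omega)]
      push_cast
      rw [add_assoc, pow_add]
      field_simp
    have hlast := lam_two_pow_add_last n K hK.symm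
    conv_lhs => rw [hK]
    conv_rhs => rw [hK]
    rw [Finset.sum_range_succ, Finset.sum_range_succ, ← hK, Finset.sum_congr rfl hterm, hlast,
      Finset.sum_neg_distrib, ← Finset.sum_mul, add_assoc, pow_add q (2 ^ n), ← hK]
    push_cast
    field_simp
    ring
  rw [prefixVal, prefixVal, pow_succ, mul_two, Finset.sum_range_add, hsum]
  ring

theorem sum_inv_pow {q : ℝ} (hq : 1 < q) (L : ℕ) :
    ∑ i ∈ Finset.range L, 1 / q ^ (i + 1) = (1 - (q ^ L)⁻¹) / (q - 1) := by
  have h1 : q - 1 ≠ 0 := by linarith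
  have h0 : q ≠ 0 := by linarith
  induction L with
  | zero => simp
  | succ L ih =>
    rw [Finset.sum_range_succ, ih, pow_succ]
    field_simp
    ring

theorem le_prefixVal_lam {M : ℕ} {p q : ℝ} (hp : isKLBase (M + 2) p) (hq : 2 < q) (hqp : q ≤ p) :
    (q - 2) / (q - 1) * (1 + (q ^ 2 ^ M)⁻¹) ≤ prefixVal q (2 ^ M) (fun i => lam (i + 1)) := by
  have hq0 : 0 < q := by linarith
  have hq1 : 0 < q - 1 := by linarith
  have hone : (1 : ℝ) ≤ ∑ i ∈ Finset.range (2 ^ (M + 1)), ((lam (i + 1) : ℝ) + 1) / q ^ (i + 1) := by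
    have h := hp.2
    rw [show M + 2 - 1 = M + 1 by omega, length_klWord] at h
    refine h.trans_le (Finset.sum_le_sum fun i hi => ?_)
    have h1 : ((klWord (M + 1)).getD i 0 : ℝ) = (lam (i + 1) : ℝ) + 1 := by
      exact_mod_cast getD_klWord (M + 1) i (Finset.mem_range.1 hi)
    rw [← h1]
    gcongr
  have hsplit : ∑ i ∈ Finset.range (2 ^ (M + 1)), ((lam (i + 1) : ℝ) + 1) / q ^ (i + 1) =
      prefixVal q (2 ^ (M + 1)) (fun i => lam (i + 1)) +
        (1 - (q ^ 2 ^ (M + 1))⁻¹) / (q - 1) := by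
    rw [← sum_inv_pow (by linarith), prefixVal, ← Finset.sum_add_distrib]
    exact Finset.sum_congr rfl fun i _ => by rw [add_div]
  rw [hsplit, prefixVal_lam_double hq0, pow_succ 2 M, pow_mul, ← inv_pow (q ^ 2 ^ M)] at hone
  have hu1 : (q ^ 2 ^ M)⁻¹ < 1 :=
    inv_lt_one_of_one_lt₀ (one_lt_pow₀ (by linarith) (by positivity))
  generalize (q ^ 2 ^ M)⁻¹ = u at hone hu1 ⊢
  generalize prefixVal q (2 ^ M) (fun i => lam (i + 1)) = S at hone ⊢
  have h1 : (q - 2) / (q - 1) * (1 + u) * (1 - u) ≤ S * (1 - u) := by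
    have : (q - 2) / (q - 1) * (1 + u) * (1 - u) =
        1 - u ^ 2 - (1 - u ^ 2) / (q - 1) := by
      field_simp
      ring
    linarith
  exact le_of_mul_le_mul_right h1 (by linarith)

/-! ### Expansions over `{-1, 0, 1}` -/

/-- The number represented by a digit sequence in base `q`. -/
def expVal (q : ℝ) (x : ℕ → ℤ) : ℝ := ∑' i, (x i : ℝ) / q ^ (i + 1)

/-- All terms lie in `{-1, 0, 1}`. -/
def IsDigitSeq (x : ℕ → ℤ) : Prop := ∀ i, x i ∈ ({-1, 0, 1} : Set ℤ)

theorem IsDigitSeq.bounds {x : ℕ → ℤ} (hx : IsDigitSeq x) (i : ℕ) : -1 ≤ x i ∧ x i ≤ 1 := by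
  have := hx i
  simp only [Set.mem_insert_iff, Set.mem_singleton_iff] at this
  omega

theorem isDigitSeq_of_bounds {x : ℕ → ℤ} (hx : ∀ i, -1 ≤ x i ∧ x i ≤ 1) : IsDigitSeq x := by
  intro i
  have := hx i
  simp only [Set.mem_insert_iff, Set.mem_singleton_iff]
  omega

theorem IsDigitSeq.neg {x : ℕ → ℤ} (hx : IsDigitSeq x) : IsDigitSeq (-x) :=
  isDigitSeq_of_bounds fun i => by
    have := hx.bounds i
    simp only [Pi.neg_apply]
    omega

theorem hasSum_inv_pow_succ {q : ℝ} (hq : 1 < q) :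
    HasSum (fun i : ℕ => 1 / q ^ (i + 1)) (1 / (q - 1)) := by
  have h := (hasSum_geometric_of_lt_one (r := q⁻¹) (by positivity)
    (inv_lt_one_of_one_lt₀ hq)).mul_left q⁻¹
  have h1 : q - 1 ≠ 0 := by linarith
  have h0 : q ≠ 0 := by linarith
  have hval : q⁻¹ * (1 - q⁻¹)⁻¹ = 1 / (q - 1) := by
    rw [← mul_inv, mul_sub, mul_one, mul_inv_cancel₀ h0, one_div]
  rw [hval] at h
  simpa only [one_div, inv_pow, pow_succ', mul_inv] using h

theorem abs_digit_div_le {q : ℝ} (hq : 1 < q) {x : ℕ → ℤ} (hx : IsDigitSeq x) (i : ℕ) :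
    ‖(x i : ℝ) / q ^ (i + 1)‖ ≤ 1 / q ^ (i + 1) := by
  have hq0 : 0 < q := by linarith
  rw [Real.norm_eq_abs, abs_div, abs_of_pos (a := q ^ (i + 1)) (by positivity)]
  have h : |(x i : ℝ)| ≤ 1 := by
    rw [abs_le]
    exact_mod_cast hx.bounds i
  gcongr

theorem summable_digits {q : ℝ} (hq : 1 < q) {x : ℕ → ℤ} (hx : IsDigitSeq x) :
    Summable fun i => (x i : ℝ) / q ^ (i + 1) :=
  Summable.of_norm_bounded (hasSum_inv_pow_succ hq).summable (abs_digit_div_le hq hx)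

theorem abs_expVal_le {q : ℝ} (hq : 1 < q) {x : ℕ → ℤ} (hx : IsDigitSeq x) :
    |expVal q x| ≤ 1 / (q - 1) :=
  tsum_of_norm_bounded (hasSum_inv_pow_succ hq) (abs_digit_div_le hq hx)

theorem expVal_neg (q : ℝ) (x : ℕ → ℤ) : expVal q (-x) = -expVal q x := by
  rw [expVal, expVal, ← tsum_neg]
  exact tsum_congr fun i => by simp [neg_div]

theorem expVal_succ {q : ℝ} (hq : 1 < q) {x : ℕ → ℤ} (hx : IsDigitSeq x) :
    expVal q x = (x 0 + expVal q fun i => x (i + 1)) / q := by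
  rw [expVal, (summable_digits hq hx).tsum_eq_zero_add, expVal, add_div, ← tsum_div_const]
  congr 1
  · simp
  · exact tsum_congr fun i => by rw [div_div, ← pow_succ]

/-- Prepending a digit. -/
def consSeq (d : ℤ) (x : ℕ → ℤ) : ℕ → ℤ
  | 0 => d
  | i + 1 => x i

theorem isDigitSeq_consSeq {d : ℤ} {x : ℕ → ℤ} (hd : -1 ≤ d ∧ d ≤ 1) (hx : IsDigitSeq x) :
    IsDigitSeq (consSeq d x) := by
  refine isDigitSeq_of_bounds fun i => ?_
  cases i with
  | zero => exact hd
  | succ i => exact hx.bounds i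

theorem expVal_consSeq {q : ℝ} (hq : 1 < q) {d : ℤ} {x : ℕ → ℤ} (hd : -1 ≤ d ∧ d ≤ 1)
    (hx : IsDigitSeq x) : expVal q (consSeq d x) = (d + expVal q x) / q :=
  expVal_succ hq (isDigitSeq_consSeq hd hx)

theorem exists_digit {q r : ℝ} (hq1 : 1 < q) (hq : q ≤ 3) (hr : |r| ≤ 1 / (q - 1)) :
    ∃ d : ℤ, (-1 ≤ d ∧ d ≤ 1) ∧ |q * r - d| ≤ 1 / (q - 1) := by
  have h1 : 0 < q - 1 := by linarith
  have hhalf : 1 / 2 ≤ 1 / (q - 1) := by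
    gcongr
    linarith
  have hB : q * (1 / (q - 1)) = 1 + 1 / (q - 1) := by field_simp; ring
  generalize 1 / (q - 1) = B at hr hhalf hB ⊢
  obtain ⟨hr1, hr2⟩ := abs_le.1 hr
  have hr3 : q * r ≤ 1 + B := by rw [← hB]; gcongr
  have hr4 : -(1 + B) ≤ q * r := by
    rw [← hB, ← mul_neg]
    gcongr
  rcases lt_or_ge (q * r) (-(1 / 2)) with h | h
  · exact ⟨-1, by norm_num, abs_le.2 ⟨by push_cast; linarith, by push_cast; linarith⟩⟩
  rcases lt_or_ge (1 / 2) (q * r) with h' | h'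
  · exact ⟨1, by norm_num, abs_le.2 ⟨by push_cast; linarith, by push_cast; linarith⟩⟩
  · exact ⟨0, by norm_num, abs_le.2 ⟨by push_cast; linarith, by push_cast; linarith⟩⟩

/-- For `q ≤ 3` every point of `[-1/(q-1), 1/(q-1)]` has an expansion over `{-1, 0, 1}`. -/
theorem exists_expansion {q r : ℝ} (hq1 : 1 < q) (hq : q ≤ 3) (hr : |r| ≤ 1 / (q - 1)) :
    ∃ x, IsDigitSeq x ∧ expVal q x = r := by
  have hq0 : 0 < q := by linarith
  choose! d hd hd' using fun r hr => exists_digit (r := r) hq1 hq hr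
  set R : ℕ → ℝ := fun n => Nat.rec r (fun _ s => q * s - d s) n with hR
  have hRs (n : ℕ) : R (n + 1) = q * R n - d (R n) := rfl
  have hRb (n : ℕ) : |R n| ≤ 1 / (q - 1) := by
    induction n with
    | zero => exact hr
    | succ n ih => exact hd' _ ih
  have hx : IsDigitSeq fun n => d (R n) := isDigitSeq_of_bounds fun n => hd _ (hRb n)
  refine ⟨fun n => d (R n), hx, ?_⟩
  have hpart (n : ℕ) :
      ∑ i ∈ Finset.range n, (d (R i) : ℝ) / q ^ (i + 1) = r - R n * q⁻¹ ^ n := by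
    induction n with
    | zero => simp [hR]
    | succ n ih =>
      rw [Finset.sum_range_succ, ih, hRs, inv_pow, inv_pow, pow_succ]
      field_simp
      ring
  have hlim := (summable_digits hq1 hx).hasSum.tendsto_sum_nat
  have hlim' : Tendsto (fun n => r - R n * q⁻¹ ^ n) atTop (nhds (r - 0)) := by
    refine tendsto_const_nhds.sub ?_
    refine squeeze_zero_norm (a := fun n => 1 / (q - 1) * q⁻¹ ^ n) (fun n => ?_) ?_
    · rw [norm_mul, norm_pow, Real.norm_eq_abs, Real.norm_eq_abs, abs_of_pos (inv_pos.2 hq0)]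
      have := hRb n
      gcongr
    · rw [← mul_zero (1 / (q - 1))]
      exact (tendsto_pow_atTop_nhds_zero_of_lt_one (by positivity)
        (inv_lt_one_of_one_lt₀ hq1)).const_mul _
  simp only [hpart] at hlim
  rw [expVal, tendsto_nhds_unique hlim hlim', sub_zero]

/-! ### Unique expansions -/

theorem uniqSeqSet_tail {q : ℝ} (hq : 1 < q) {x : ℕ → ℤ} (hx : x ∈ uniqSeqSet q) :
    (fun i => x (i + 1)) ∈ uniqSeqSet q := by
  obtain ⟨hd, hu⟩ := hx
  refine ⟨fun i => hd (i + 1), fun s hs hval => ?_⟩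
  have hb := IsDigitSeq.bounds hd 0
  have h := hu (consSeq (x 0) s) (isDigitSeq_consSeq hb hs) (by
    change expVal q _ = expVal q _
    rw [expVal_consSeq hq hb hs, expVal_succ hq hd]
    congr 2)
  funext i
  exact congrFun h (i + 1)

theorem uniqSeqSet_drop {q : ℝ} (hq : 1 < q) {x : ℕ → ℤ} (hx : x ∈ uniqSeqSet q) (n : ℕ) :
    (fun i => x (n + i)) ∈ uniqSeqSet q := by
  induction n with
  | zero => simpa using hx
  | succ n ih => simpa [add_assoc, add_comm, add_left_comm] using uniqSeqSet_tail hq ih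

theorem uniqSeqSet_neg {q : ℝ} {x : ℕ → ℤ} (hx : x ∈ uniqSeqSet q) : -x ∈ uniqSeqSet q := by
  obtain ⟨hd, hu⟩ := hx
  refine ⟨IsDigitSeq.neg hd, fun s hs hval => ?_⟩
  have h := hu (-s) (IsDigitSeq.neg hs) (by
    change expVal q _ = expVal q _
    change expVal q _ = expVal q _ at hval
    rw [expVal_neg, hval, expVal_neg, neg_neg])
  rw [← h, neg_neg]

theorem expVal_tail_lt {q : ℝ} (hq1 : 2 < q) (hq : q ≤ 3) {x : ℕ → ℤ} (hx : x ∈ uniqSeqSet q)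
    (h0 : x 0 < 1) : expVal q (fun i => x (i + 1)) < (q - 2) / (q - 1) := by
  by_contra! hge
  obtain ⟨hd, hu⟩ := hx
  have hq' : 1 < q := by linarith
  have hle := (abs_le.1 (abs_expVal_le hq' (x := fun i => x (i + 1)) fun i => hd (i + 1))).2
  have heq : (q - 2) / (q - 1) = 1 - 1 / (q - 1) := by
    have : q - 1 ≠ 0 := by linarith
    field_simp
    ring
  obtain ⟨s, hs, hval⟩ := exists_expansion (r := expVal q (fun i => x (i + 1)) - 1) hq' hq
    (abs_le.2 ⟨by linarith, by linarith⟩)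
  have hb := IsDigitSeq.bounds hd 0
  have hb' : -1 ≤ x 0 + 1 ∧ x 0 + 1 ≤ 1 := by omega
  have h := hu (consSeq (x 0 + 1) s) (isDigitSeq_consSeq hb' hs) (by
    change expVal q _ = expVal q _
    rw [expVal_consSeq hq' hb' hs, expVal_succ hq' hd, hval]
    push_cast
    ring)
  have := congrFun h 0
  simp [consSeq] at this

theorem eventually_expVal_lt {q : ℝ} (hq1 : 2 < q) (hq : q < 3) {x : ℕ → ℤ}
    (hx : x ∈ uniqSeqSet q) (h1 : ¬∀ i, x i = 1) :
    ∃ N, ∀ n ≥ N, expVal q (fun i => x (n + i)) < (q - 2) / (q - 1) := by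
  have hq' : 1 < q := by linarith
  have hstep (n : ℕ) (hn : x n < 1) :
      expVal q (fun i => x (n + 1 + i)) < (q - 2) / (q - 1) := by
    simpa [add_assoc, add_comm, add_left_comm] using
      expVal_tail_lt hq1 hq.le (uniqSeqSet_drop hq' hx n) hn
  obtain ⟨N, hN⟩ := not_forall.1 h1
  have hN' := IsDigitSeq.bounds hx.1
  refine ⟨N + 1, fun n hn => ?_⟩
  induction n, hn using Nat.le_induction with
  | base => exact hstep N (by have := hN' N; omega)
  | succ n hn ih =>
    rcases (hN' n).2.lt_or_eq with h | h
    · exact hstep n h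
    · have hs := expVal_succ hq' (x := fun i => x (n + i)) fun i => hx.1 _
      have hs' : (fun i => x (n + (i + 1))) = fun i => x (n + 1 + i) := by
        funext i
        congr 1
        ring
      simp only [add_zero, h, hs', Int.cast_one] at hs
      rw [hs, div_lt_iff₀ (by linarith)] at ih
      have hk : (q - 2) / (q - 1) * q = (q - 2) / (q - 1) + (q - 2) := by
        have : q - 1 ≠ 0 := by linarith
        field_simp
        ring
      linarith

theorem prefixVal_le {q : ℝ} (hq : 1 < q) (L : ℕ) {c : ℕ → ℤ} (hc : ∀ i, c i ≤ 1) :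
    prefixVal q L c ≤ 1 / (q - 1) := by
  have h1 : 0 < q - 1 := by linarith
  induction L generalizing c with
  | zero => simpa [prefixVal] using h1.le
  | succ L ih =>
    rw [prefixVal_succ, div_le_iff₀ (by linarith)]
    have h2 := ih (c := fun i => c (i + 1)) fun i => hc (i + 1)
    have h3 : (c 0 : ℝ) ≤ 1 := by exact_mod_cast hc 0
    have h4 : 1 / (q - 1) * q = 1 + 1 / (q - 1) := by field_simp; ring
    linarith

/-- A sequence that is lexicographically at least `c₁ ⋯ c_L`, and all of whose tails are large,
represents a large number. -/
theorem lt_expVal_of_not_prefixLT {q : ℝ} (hq : 2 < q) (L : ℕ) {a c : ℕ → ℤ}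
    (ha : IsDigitSeq a) (hc : ∀ i, c i ≤ 1)
    (hlow : ∀ n, -((q - 2) / (q - 1)) < expVal q fun i => a (n + i))
    (h : ¬PrefixLT L a c) :
    prefixVal q L c - (q ^ L)⁻¹ * ((q - 2) / (q - 1)) < expVal q a := by
  have hq0 : 0 < q := by linarith
  have hq1 : 0 < q - 1 := by linarith
  induction L generalizing a c with
  | zero => simpa [prefixVal] using hlow 0
  | succ L ih =>
    have hlow' : ∀ n, -((q - 2) / (q - 1)) < expVal q fun i => a (n + i + 1) := fun n => by
      simpa [add_assoc, add_comm, add_left_comm] using hlow (n + 1)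
    have hinv : (q ^ (L + 1))⁻¹ * ((q - 2) / (q - 1)) =
        (q ^ L)⁻¹ * ((q - 2) / (q - 1)) / q := by
      rw [pow_succ]
      field_simp
    rw [prefixVal_succ, expVal_succ (by linarith) ha, hinv, ← sub_div]
    refine div_lt_div_of_pos_right ?_ hq0
    have h0 : c 0 ≤ a 0 := by
      by_contra! h0
      exact h ⟨0, by omega, by simp, h0⟩
    rcases h0.eq_or_lt with h0 | h0
    · have := ih (a := fun i => a (i + 1)) (c := fun i => c (i + 1)) (fun i => ha _)
        (fun i => hc _) hlow' fun ⟨i, hi, hieq, hilt⟩ =>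
          h ⟨i + 1, by omega, fun k hk => by
            cases k with
            | zero => exact h0.symm
            | succ k => exact hieq k (by omega), hilt⟩
      rw [h0]
      linarith
    · have h1 : (c 0 : ℝ) + 1 ≤ a 0 := by exact_mod_cast h0
      have h2 := hlow' 0
      simp only [zero_add] at h2
      have h3 := prefixVal_le (q := q) (by linarith) L (c := fun i => c (i + 1)) fun i => hc _
      have h4 : (q - 2) / (q - 1) = 1 - 1 / (q - 1) := by field_simp; ring
      have h5 : 0 ≤ (q ^ L)⁻¹ * ((q - 2) / (q - 1)) := by
        have : 0 ≤ q - 2 := by linarith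
        positivity
      linarith

theorem belowEps_of_abs_lt {M N : ℕ} {p q : ℝ} (hp : isKLBase (M + 2) p) (hq : 2 < q)
    (hqp : q ≤ p) {x : ℕ → ℤ} (hx : IsDigitSeq x)
    (hhigh : ∀ n ≥ N, expVal q (fun i => x (n + i)) < (q - 2) / (q - 1))
    (hlow : ∀ n ≥ N, -((q - 2) / (q - 1)) < expVal q (fun i => x (n + i))) :
    BelowEps M N x := by
  intro n hn
  by_contra h
  have h1 := lt_expVal_of_not_prefixLT hq (2 ^ M) (fun i => hx (n + i))
    (fun i => (lam_succ_mem i).2)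
    (fun k => by simpa [add_assoc] using hlow (n + k) (by omega)) h
  have h2 := le_prefixVal_lam hp hq hqp
  have h3 := hhigh n hn
  linarith

/-- For `q ≤ q_{M+2}`, a nonconstant unique expansion ends with `0^∞` or with some
`(ε_n ε̄_n)^∞`, `n < M`. -/
theorem uniqSeqSet_tail_zero_or_per {M : ℕ} {p q : ℝ} (hp : isKLBase (M + 2) p) (hq : 2 < q)
    (hqp : q ≤ p) {x : ℕ → ℤ} (hx : x ∈ uniqSeqSet q) (h1 : ¬∀ i, x i = 1)
    (h2 : ¬∀ i, x i = -1) :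
    (∃ a, ∀ i, x (a + i) = 0) ∨
      ∃ n < M, ∃ a, ∀ i, x (a + i) = per (eps n ++ reflect (eps n)) i := by
  have hq3 : q < 3 := hqp.trans_lt hp.1.2
  obtain ⟨N₁, hN₁⟩ := eventually_expVal_lt hq hq3 hx h1
  obtain ⟨N₂, hN₂⟩ := eventually_expVal_lt hq hq3 (uniqSeqSet_neg hx) fun h =>
    h2 fun i => by have := h i; simp only [Pi.neg_apply] at this; omega
  have hneg (n : ℕ) : expVal q (fun i => (-x) (n + i)) = -expVal q (fun i => x (n + i)) :=
    expVal_neg q fun i => x (n + i)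
  simp only [hneg] at hN₂
  have hhigh (n : ℕ) (hn : n ≥ max N₁ N₂) := hN₁ n ((le_max_left _ _).trans hn)
  have hlow (n : ℕ) (hn : n ≥ max N₁ N₂) := hN₂ n ((le_max_right _ _).trans hn)
  refine tail_zero_or_per (N := max N₁ N₂) (belowEps_of_abs_lt hp hq hqp hx.1 hhigh fun n hn => ?_)
    (belowEps_of_abs_lt hp hq hqp (IsDigitSeq.neg hx.1) (fun n hn => ?_) fun n hn => ?_)
  · linarith [hlow n hn]
  · rw [hneg]
    exact hlow n hn
  · rw [hneg]
    linarith [hhigh n hn]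

theorem mem_uniqSeqSet_of_expVal_mem {q : ℝ} {x : ℕ → ℤ} (hx : IsDigitSeq x)
    (h : expVal q x ∈ uniqSet q) : x ∈ uniqSeqSet q := by
  have hcast {z : ℕ → ℤ} (hz : IsDigitSeq z) (i : ℕ) : (z i : ℝ) ∈ ({-1, 0, 1} : Set ℝ) := by
    have := hz i
    simp only [Set.mem_insert_iff, Set.mem_singleton_iff] at this ⊢
    exact_mod_cast this
  refine ⟨hx, fun s hs hval => ?_⟩
  have h' := h.2.unique (y₁ := fun i => (s i : ℝ)) (y₂ := fun i => (x i : ℝ))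
    ⟨hcast hs, hval.symm⟩ ⟨hcast hx, rfl⟩
  funext i
  exact_mod_cast congrFun h' i

theorem tsum_smul_pair {q : ℝ} (hq : 1 < q) {ts : ℕ → ℤ × ℤ}
    (h1 : IsDigitSeq fun i => (ts i).1) (h2 : IsDigitSeq fun i => (ts i).2) :
    ∑' i, (q ^ (i + 1))⁻¹ • ((((ts i).1 : ℝ), ((ts i).2 : ℝ)) : ℝ × ℝ) =
      (expVal q fun i => (ts i).1, expVal q fun i => (ts i).2) := by
  have h := (summable_digits hq h1).hasSum.prodMk (summable_digits hq h2).hasSum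
  refine Eq.trans (tsum_congr fun i => ?_) h.tsum_eq
  simp only [Prod.smul_mk, smul_eq_mul, div_eq_inv_mul]

theorem stmt13 (m : ℕ) (hm : 1 ≤ m) (qm qm1 q : ℝ)
    (hqm : isKLBase m qm) (hqm1 : isKLBase (m + 1) qm1) (hq : q ∈ Set.Ioc qm qm1)
    (t : ℝ × ℝ) (ht : t ∈ Tset q)
    (ts : ℕ → ℤ × ℤ) (hts : ∀ i, ts i ∈ Omega2Z)
    (hexp : t = ∑' i, (q ^ (i + 1))⁻¹ • ((((ts i).1 : ℝ), ((ts i).2 : ℝ)) : ℝ × ℝ))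
    (h1 : ¬∀ i, (ts i).1 = -1) (h2 : ¬∀ i, (ts i).1 = 1)
    (h3 : ¬∀ i, (ts i).2 = -1) (h4 : ¬∀ i, (ts i).2 = 1)
    (hinf : {i | ts i = (0, 0)}.Infinite) :
    (∃ k, ∀ j, (ts (j + k)).1 = 0) ∨ (∃ k, ∀ j, (ts (j + k)).2 = 0) ∨
      ∃ n, 1 ≤ n ∧ n < m ∧ ∃ k, ∀ j,
        ts (j + k) = (per (eps n ++ reflect (eps n)) j,
                      per (reflect (eps n) ++ eps n) j) := by
  obtain ⟨M, rfl⟩ := Nat.exists_eq_add_of_le' hm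
  have hq2 : 2 < q := hqm.1.1.trans hq.1
  have hq1 : 1 < q := by linarith
  have hdig (i : ℕ) : (-1 ≤ (ts i).1 ∧ (ts i).1 ≤ 1) ∧ (-1 ≤ (ts i).2 ∧ (ts i).2 ≤ 1) ∧
      ¬((ts i).1 = 1 ∧ (ts i).2 = 1) ∧ ¬((ts i).1 = -1 ∧ (ts i).2 = -1) := by
    have h := hts i
    simp only [Omega2Z, Set.mem_insert_iff, Set.mem_singleton_iff] at h
    rcases h with h | h | h | h | h | h | h <;> rw [h] <;> norm_num
  have hx : IsDigitSeq fun i => (ts i).1 := isDigitSeq_of_bounds fun i => (hdig i).1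
  have hy : IsDigitSeq fun i => (ts i).2 := isDigitSeq_of_bounds fun i => (hdig i).2.1
  rw [tsum_smul_pair hq1 hx hy] at hexp
  subst hexp
  have hxu := mem_uniqSeqSet_of_expVal_mem hx ht.2.1
  have hyu := mem_uniqSeqSet_of_expVal_mem hy ht.2.2
  rcases uniqSeqSet_tail_zero_or_per hqm1 hq2 hq.2 hxu h2 h1 with ⟨a, ha⟩ | ⟨n, hn, a, ha⟩
  · exact Or.inl ⟨a, fun j => by rw [add_comm]; exact ha j⟩
  rcases uniqSeqSet_tail_zero_or_per hqm1 hq2 hq.2 hyu h4 h3 with ⟨b, hb⟩ | ⟨k, -, b, hb⟩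
  · exact Or.inr (Or.inl ⟨b, fun j => by rw [add_comm]; exact hb j⟩)
  obtain ⟨p, hp, hpab⟩ := hinf.exists_gt (max a b)
  have hp0 : ts p = (0, 0) := hp
  obtain ⟨hap, hbp⟩ := max_lt_iff.1 hpab
  have hopp := eq_neg_of_both_zero ha hb hap.le hbp.le (by simp [hp0]) (by simp [hp0])
    (fun i => (hdig i).2.2.1) (fun i => (hdig i).2.2.2)
  have hn1 : 1 ≤ n := by
    refine Nat.one_le_iff_ne_zero.2 ?_
    rintro rfl
    obtain ⟨c, rfl⟩ := Nat.exists_eq_add_of_le hap.le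
    exact per_eps_zero_ne_zero c (by rw [← ha]; simp [hp0])
  refine Or.inr (Or.inr ⟨n, hn1, by omega, a + 2 ^ (n + 1) * (p + 1), fun j => ?_⟩)
  have h1' : (ts (j + (a + 2 ^ (n + 1) * (p + 1)))).1 =
      per (eps n ++ reflect (eps n)) j := by
    rw [← per_add_mul_length _ j (p + 1), length_eps_append_reflect, ← ha]
    congr 2
    ring
  have hle : p + 1 ≤ j + (a + 2 ^ (n + 1) * (p + 1)) := by
    have : p + 1 ≤ 2 ^ (n + 1) * (p + 1) := Nat.le_mul_of_pos_left _ (by positivity)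
    omega
  obtain ⟨i, hi⟩ := Nat.exists_eq_add_of_le hle
  have h2' := hopp i
  rw [← hi, h1'] at h2'
  exact Prod.ext h1' (by rw [per_reflect_append]; exact h2')

end
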